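/- Let m ≥ 1 and n : Fin m → ℕ, and work in the space W of tuples w = (w₁, …, w_m) with w_i ∈ ℝ^{n_i}, equipped with the ℓ² product norm ‖w‖² = Σᵢ ‖wᵢ‖₂². Let w* ∈ W satisfy w*ᵢ ≠ 0 for every i, let λ > 0 and let s : Fin m → ℝ. Then the tuple ŵ defined groupwise by ŵᵢ = (1 − λ·sᵢ/‖w*ᵢ‖₂)₊ · w*ᵢ is a global minimizer over W of the structured objective F(w) = (1/2)·Σᵢ ‖w*ᵢ − wᵢ‖₂² + λ·Σᵢ sᵢ·‖wᵢ‖₂. -/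

import Mathlib

/-- Soft-thresholding minimizes `x ↦ (x - r)² / 2 + c * x` over the nonnegative reals. -/
theorem half_sq_sub_add_mul_max_le (r c : ℝ) {t : ℝ} (ht : 0 ≤ t) :
    (1 / 2) * (r - max (r - c) 0) ^ 2 + c * max (r - c) 0
      ≤ (1 / 2) * (r - t) ^ 2 + c * t := by
  rcases le_total (r - c) 0 with h | h
  · rw [max_eq_right h]
    nlinarith [sq_nonneg t, mul_nonneg ht (neg_nonneg.2 h)]
  · rw [max_eq_left h]
    nlinarith [sq_nonneg (r - c - t)]

/-- Soft-thresholding of a nonzero vector `v` minimizes `u ↦ ‖v - u‖² / 2 + c * ‖u‖`. -/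
theorem half_norm_sub_softThreshold_sq_add_le {E : Type*} [NormedAddCommGroup E]
    [NormedSpace ℝ E] {v : E} (hv : v ≠ 0) (c : ℝ) (u : E) :
    (1 / 2) * ‖v - max (1 - c / ‖v‖) 0 • v‖ ^ 2 + c * ‖max (1 - c / ‖v‖) 0 • v‖
      ≤ (1 / 2) * ‖v - u‖ ^ 2 + c * ‖u‖ := by
  have hr : 0 < ‖v‖ := norm_pos_iff.2 hv
  set k := max (1 - c / ‖v‖) 0 with hk
  have hkr : k * ‖v‖ = max (‖v‖ - c) 0 := by
    rw [hk, max_mul_of_nonneg _ _ hr.le, zero_mul, sub_mul, one_mul, div_mul_cancel₀ _ hr.ne']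
  have hsub : ‖v - k • v‖ ^ 2 = (‖v‖ - k * ‖v‖) ^ 2 := by
    rw [show v - k • v = (1 - k) • v by rw [sub_smul, one_smul], norm_smul, mul_pow,
      Real.norm_eq_abs, sq_abs]
    ring
  rw [hsub, norm_smul, Real.norm_of_nonneg (le_max_right _ _ : 0 ≤ k), hkr]
  have hle : (‖v‖ - ‖u‖) ^ 2 ≤ ‖v - u‖ ^ 2 :=
    sq_le_sq.2 ((abs_norm_sub_norm_le v u).trans (le_abs_self _))
  linarith [half_sq_sub_add_mul_max_le ‖v‖ c (norm_nonneg u)]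

/-- groupwise soft-thresholding `ŵᵢ = (1 − λsᵢ/‖w*ᵢ‖₂)₊ · w*ᵢ` minimizes the
structured objective `F(w) = (1/2)·Σᵢ ‖w*ᵢ − wᵢ‖₂² + λ·Σᵢ sᵢ·‖wᵢ‖₂` over the ℓ² product space. -/
theorem stmt_12 (m : ℕ) (hm : 1 ≤ m) (n : Fin m → ℕ)
    (wstar : PiLp 2 (fun i : Fin m => EuclideanSpace ℝ (Fin (n i))))
    (hwstar : ∀ i, wstar i ≠ 0) (lam : ℝ) (hlam : 0 < lam) (s : Fin m → ℝ)
    (what : PiLp 2 (fun i : Fin m => EuclideanSpace ℝ (Fin (n i))))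
    (hwhat : ∀ i, what i = (max (1 - lam * s i / ‖wstar i‖) 0) • wstar i) :
    ∀ w : PiLp 2 (fun i : Fin m => EuclideanSpace ℝ (Fin (n i))),
      (1 / 2) * ∑ i, ‖wstar i - what i‖ ^ 2 + lam * ∑ i, s i * ‖what i‖
        ≤ (1 / 2) * ∑ i, ‖wstar i - w i‖ ^ 2 + lam * ∑ i, s i * ‖w i‖ := by
  intro w
  simp only [Finset.mul_sum, ← Finset.sum_add_distrib, ← mul_assoc lam]
  refine Finset.sum_le_sum fun i _ => ?_
  rw [hwhat i]
  exact half_norm_sub_softThreshold_sq_add_le (hwstar i) (lam * s i) (w i)
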